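/- Let 1 ≤ p < q ≤ r and c, c′ ∈ 𝔞, and set h := [EBL_{p,q}(c), EUR_{q,p}(c′)]. Suppose that [h, X_q] = −X_q and [h, X_p] = (−1 + δ_{q,p+1})·X_p, where X_j := EUL_{j,j+1}(1) for 1 ≤ j ≤ r−1 and X_r := Evert_r(√2·1) (with √2·1 the image of √2 ∈ ℂ in 𝔞). Then c′·c = 1 and c·c′ = 1; in particular c is invertible in 𝔞 with inverse c′. -/

import Mathlib

namespace GIMPaper

/-- The paper's `E_{i,j}(a)`: the `(2r+1) × (2r+1)` matrix over `A` whose entry at the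
(1-based) position `(i, j)` is `a` and all of whose other entries are `0`. -/
def E (A : Type*) [Ring A] (r i j : ℕ) (a : A) :
    Matrix (Fin (2 * r + 1)) (Fin (2 * r + 1)) A :=
  fun x y => if (x : ℕ) + 1 = i ∧ (y : ℕ) + 1 = j then a else 0

/-- `Evert_k(a) = E_{k,r+1}(a) + E_{r+1,2r+2-k}(-η a)`. -/
def Evert (A : Type*) [Ring A] (r : ℕ) (η : A → A) (k : ℕ) (a : A) :
    Matrix (Fin (2 * r + 1)) (Fin (2 * r + 1)) A :=
  E A r k (r + 1) a + E A r (r + 1) (2 * r + 2 - k) (-η a)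

/-- `Ehort_k(a) = E_{r+1,k}(a) + E_{2r+2-k,r+1}(-η a)`. -/
def Ehort (A : Type*) [Ring A] (r : ℕ) (η : A → A) (k : ℕ) (a : A) :
    Matrix (Fin (2 * r + 1)) (Fin (2 * r + 1)) A :=
  E A r (r + 1) k a + E A r (2 * r + 2 - k) (r + 1) (-η a)

/-- `EUL_{p,q}(a) = E_{p,q}(a) + E_{2r+2-q,2r+2-p}(-η a)`. -/
def EUL (A : Type*) [Ring A] (r : ℕ) (η : A → A) (p q : ℕ) (a : A) :
    Matrix (Fin (2 * r + 1)) (Fin (2 * r + 1)) A :=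
  E A r p q a + E A r (2 * r + 2 - q) (2 * r + 2 - p) (-η a)

/-- `EUR_{p,q}(a) = E_{p,2r+2-q}(a) + E_{q,2r+2-p}(-η a)`. -/
def EUR (A : Type*) [Ring A] (r : ℕ) (η : A → A) (p q : ℕ) (a : A) :
    Matrix (Fin (2 * r + 1)) (Fin (2 * r + 1)) A :=
  E A r p (2 * r + 2 - q) a + E A r q (2 * r + 2 - p) (-η a)

/-- `EBL_{p,q}(a) = E_{2r+2-p,q}(a) + E_{2r+2-q,p}(-η a)`. -/
def EBL (A : Type*) [Ring A] (r : ℕ) (η : A → A) (p q : ℕ) (a : A) :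
    Matrix (Fin (2 * r + 1)) (Fin (2 * r + 1)) A :=
  E A r (2 * r + 2 - p) q a + E A r (2 * r + 2 - q) p (-η a)

end GIMPaper

open GIMPaper

/-- `X_j := EUL_{j,j+1}(1)` for `j ≠ r` and `X_r := Evert_r(√2 · 1)`, where `√2 · 1` is the
image of `√2 ∈ ℂ` in `A`. -/
noncomputable def Xgen (A : Type*) [Ring A] [Algebra ℂ A] (r : ℕ) (η : A → A) (j : ℕ) :
    Matrix (Fin (2 * r + 1)) (Fin (2 * r + 1)) A :=
  if j = r then Evert A r η r (algebraMap ℂ A ((Real.sqrt 2 : ℝ) : ℂ))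
  else EUL A r η j (j + 1) (1 : A)

theorem GIMaux.E_mul_same (A : Type*) [Ring A] (r i j l : ℕ) (a b : A)
    (h1 : 1 ≤ j) (h2 : j ≤ 2 * r + 1) :
    E A r i j a * E A r j l b = E A r i l (a * b) := by
  ext x y
  rw [Matrix.mul_apply, Finset.sum_eq_single (⟨j - 1, by omega⟩ : Fin (2 * r + 1))]
  · have : j - 1 + 1 = j := by omega
    simp only [E, this]
    by_cases hx : (x : ℕ) + 1 = i <;> by_cases hy : (y : ℕ) + 1 = l <;> simp [hx, hy]
  · intro z _ hz
    have : (z : ℕ) + 1 ≠ j := by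
      intro h
      apply hz
      ext
      simp
      omega
    simp [E, this]
  · simp

theorem GIMaux.E_mul_ne (A : Type*) [Ring A] (r i j k l : ℕ) (a b : A) (h : j ≠ k) :
    E A r i j a * E A r k l b = 0 := by
  ext x y
  rw [Matrix.mul_apply]
  apply Finset.sum_eq_zero
  intro z _
  by_cases hz : (z : ℕ) + 1 = j
  · have : (z : ℕ) + 1 ≠ k := by omega
    simp [E, this]
  · simp [E, hz]

theorem GIMaux.h_eq (A : Type*) [Ring A] (r : ℕ) (η : A → A) (p q : ℕ) (hp1 : 1 ≤ p)
    (hpq : p < q) (hqr : q ≤ r) (c c' : A) :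
    EBL A r η p q c * EUR A r η q p c' - EUR A r η q p c' * EBL A r η p q c =
    Matrix.diagonal (fun x : Fin (2 * r + 1) =>
      if (x : ℕ) + 1 = p then -(η c' * η c) else if (x : ℕ) + 1 = q then -(c' * c)
      else if (x : ℕ) + 1 = 2 * r + 2 - p then c * c'
      else if (x : ℕ) + 1 = 2 * r + 2 - q then η c * η c' else 0) := by
  simp only [EBL, EUR, add_mul, mul_add]
  rw [GIMaux.E_mul_same _ _ _ _ _ _ _ (by omega) (by omega),
    GIMaux.E_mul_same _ _ _ _ _ _ _ (by omega) (by omega),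
    GIMaux.E_mul_same _ _ _ _ _ _ _ (by omega) (by omega),
    GIMaux.E_mul_same _ _ _ _ _ _ _ (by omega) (by omega),
    GIMaux.E_mul_ne _ _ _ _ _ _ _ _ (by omega),
    GIMaux.E_mul_ne _ _ _ _ _ _ _ _ (by omega),
    GIMaux.E_mul_ne _ _ _ _ _ _ _ _ (by omega),
    GIMaux.E_mul_ne _ _ _ _ _ _ _ _ (by omega)]
  ext x y
  by_cases hxy : x = y
  · subst hxy
    simp only [Matrix.diagonal_apply_eq, Matrix.sub_apply, Matrix.add_apply, Matrix.zero_apply, E,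
      and_self, neg_mul_neg]
    split_ifs <;> first | omega | simp
  · have hxy' : (x : ℕ) ≠ y := fun h => hxy (Fin.ext h)
    rw [Matrix.diagonal_apply_ne _ hxy]
    simp only [Matrix.sub_apply, Matrix.add_apply, Matrix.zero_apply, E]
    split_ifs <;> first | omega | simp

theorem stmt_16
    (r : ℕ) (hr : 3 ≤ r) (A : Type*) [Ring A] [Algebra ℂ A]
    (η : A → A)
    (hη_add : ∀ a b : A, η (a + b) = η a + η b)
    (hη_smul : ∀ (c : ℂ) (a : A), η (c • a) = c • η a)
    (hη_mul : ∀ a b : A, η (a * b) = η b * η a)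
    (hη_one : η (1 : A) = 1)
    (hη_invol : ∀ a : A, η (η a) = a)
    (p q : ℕ) (hp1 : 1 ≤ p) (hpq : p < q) (hqr : q ≤ r) (c c' : A)
    (h : Matrix (Fin (2 * r + 1)) (Fin (2 * r + 1)) A)
    (hh : h = EBL A r η p q c * EUR A r η q p c' - EUR A r η q p c' * EBL A r η p q c)
    (hXq : h * Xgen A r η q - Xgen A r η q * h = -Xgen A r η q)
    (hXp : h * Xgen A r η p - Xgen A r η p * h
        = ((-1 : ℤ) + (if q = p + 1 then 1 else 0)) • Xgen A r η p) :
    c' * c = 1 ∧ c * c' = 1 := by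
  rw [GIMaux.h_eq A r η p q hp1 hpq hqr] at hh
  subst hh
  -- the coefficient of `E_{q,q+1}` in the first relation
  have k1 : c' * c = 1 := by
    have e := congrFun (congrFun hXq ⟨q - 1, by omega⟩) ⟨q, by omega⟩
    have hq1 : q - 1 + 1 = q := by omega
    rw [Matrix.sub_apply, Matrix.neg_apply, Matrix.diagonal_mul, Matrix.mul_diagonal] at e
    simp only [hq1] at e
    rw [if_neg (by omega), if_pos trivial, if_neg (by omega), if_neg (by omega), if_neg (by omega)] at e
    by_cases hqr' : q = r
    · have hX : Xgen A r η q ⟨q - 1, by omega⟩ ⟨q, by omega⟩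
          = algebraMap ℂ A ((Real.sqrt 2 : ℝ) : ℂ) := by
        rw [Xgen, if_pos hqr', Evert, Matrix.add_apply, E, E]
        simp only [hq1]
        rw [if_pos (by simp [hqr']), if_neg (by omega), add_zero]
      rw [hX, if_neg (by omega)] at e
      have hs : ((Real.sqrt 2 : ℝ) : ℂ) ≠ 0 := by
        simp
      have hu : algebraMap ℂ A ((Real.sqrt 2 : ℝ) : ℂ)
          * algebraMap ℂ A (((Real.sqrt 2 : ℝ) : ℂ)⁻¹) = 1 := by
        rw [← map_mul, mul_inv_cancel₀ hs, map_one]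
      have e2 : c' * c * algebraMap ℂ A ((Real.sqrt 2 : ℝ) : ℂ)
          = algebraMap ℂ A ((Real.sqrt 2 : ℝ) : ℂ) := by
        simpa using e
      calc c' * c = c' * c * (algebraMap ℂ A ((Real.sqrt 2 : ℝ) : ℂ)
          * algebraMap ℂ A (((Real.sqrt 2 : ℝ) : ℂ)⁻¹)) := by rw [hu, mul_one]
        _ = 1 := by rw [← mul_assoc, e2, hu]
    · have hX : Xgen A r η q ⟨q - 1, by omega⟩ ⟨q, by omega⟩ = 1 := by
        rw [Xgen, if_neg hqr', EUL, Matrix.add_apply, E, E]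
        simp only [hq1]
        rw [if_pos (by simp), if_neg (by omega), add_zero]
      rw [hX, if_neg (by omega)] at e
      simpa using e
  -- the coefficient of `E_{p,p+1}` in the second relation
  have k2 : η c' * η c = 1 := by
    have e := congrFun (congrFun hXp ⟨p - 1, by omega⟩) ⟨p, by omega⟩
    have hq1 : p - 1 + 1 = p := by omega
    have hX : Xgen A r η p ⟨p - 1, by omega⟩ ⟨p, by omega⟩ = 1 := by
      rw [Xgen, if_neg (by omega), EUL, Matrix.add_apply, E, E]
      simp only [hq1]
      rw [if_pos (by simp), if_neg (by omega), add_zero]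
    rw [Matrix.sub_apply, Matrix.smul_apply, Matrix.diagonal_mul, Matrix.mul_diagonal, hX] at e
    simp only [hq1] at e
    rw [if_pos trivial, if_neg (by omega)] at e
    by_cases hqp : q = p + 1
    · rw [if_pos hqp.symm, if_pos hqp, k1] at e
      simp at e
      exact (neg_add_eq_zero.mp e)
    · rw [if_neg (by omega), if_neg (by omega), if_neg (by omega), if_neg hqp] at e
      simpa using e
  refine ⟨k1, ?_⟩
  rw [← hη_mul] at k2
  rw [← hη_invol (c * c'), k2, hη_one]
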